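/- There exists a choice function μ on a family of subsets of a finite set, arising from a (non-transitive) smooth preferential relation—hence satisfying (μ⊆) and (μPR)—such that (μCumt1) fails: concretely, over base set {a,b,c} with order c ≺ b ≺ a (non-transitive), U = {a,c}, X₀ = {b,c}, X₁ = {a,b}, one has μ(X₀) ⊆ U and μ(X₁) ⊆ U ∪ X₀, but X₁ ∩ μ(U) ⊄ μ(X₁). -/

import Mathlib

/-- A smooth (non-transitive) preferential structure whose μ satisfies (μ⊆) and (μPR)
    but where (μCumt1) fails. -/
theorem stmt_19 :
    ∃ (M : Type) (r : M → M → Prop) (μ : Set M → Set M) (U X0 X1 : Set M),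
      (∀ X : Set M, μ X = {x ∈ X | ¬∃ y ∈ X, r y x}) ∧
      (∀ X ∈ ({U, X0, X1} : Set (Set M)), ∀ x ∈ X, x ∈ μ X ∨ ∃ y ∈ μ X, r y x) ∧
      (∀ X : Set M, μ X ⊆ X) ∧
      (∀ X Y : Set M, X ⊆ Y → μ Y ∩ X ⊆ μ X) ∧
      μ X0 ⊆ U ∧ μ X1 ⊆ U ∪ X0 ∧ ¬(X1 ∩ μ U ⊆ μ X1) := by
  -- a = 0, b = 1, c = 2, with c ≺ b and b ≺ a only
  refine ⟨Fin 3, fun x y => x.val = y.val + 1,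
    fun X => {x ∈ X | ¬∃ y ∈ X, y.val = x.val + 1}, {0, 2}, {1, 2}, {0, 1},
    fun _ => rfl, ?_, fun X x hx => hx.1, ?_, ?_, ?_, ?_⟩
  · rintro X (rfl | rfl | rfl) x (rfl | rfl) <;> simp
    · exact ⟨2, by simp⟩
    · exact ⟨1, by simp⟩
  · rintro X Y h x ⟨⟨_, h2⟩, hx⟩
    exact ⟨hx, fun ⟨y, hy, hr⟩ => h2 ⟨y, h hy, hr⟩⟩
  · rintro x ⟨rfl | rfl, h⟩ <;> simp at h ⊢
  · rintro x ⟨rfl | rfl, h⟩ <;> simp at h ⊢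
  · intro h
    have h0 := @h 0 (by simp)
    simp at h0
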